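/- Let p > 1 and consider the differential equation u'' + u - u^p = 0 with potential V(u) = u^{p+1}/(p+1) - u^2/2 + (p-1)/(2(p+1)), which has its minimum at u = 1 with V(1) = 0. For energy E with 0 < E < (p-1)/(2(p+1)), let u_-(E) ∈ (0,1) and u_+(E) ∈ (1,∞) be the two solutions of V(u) = E, and define the period function T(E) = 2 ∫_{u_-(E)}^{u_+(E)} (E - V(u))^{-1/2} du. Then T is strictly monotonically increasing on the interval (0, (p-1)/(2(p+1))). -/

import Mathlib

open Set MeasureTheory

/-- The potential `V(u) = u^(p+1)/(p+1) - u^2/2 + (p-1)/(2(p+1))`. -/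
noncomputable def potential (p u : ℝ) : ℝ :=
  u ^ (p + 1) / (p + 1) - u ^ 2 / 2 + (p - 1) / (2 * (p + 1))

/-- The derivative of the potential on the positive half-line. -/
noncomputable def potentialDeriv (p u : ℝ) : ℝ := u * (u ^ (p - 1) - 1)

theorem hasDerivAt_rpow_sub_one (p : ℝ) {u : ℝ} (hu : 0 < u) :
    HasDerivAt (fun x : ℝ => x ^ (p - 1)) ((p - 1) * u ^ (p - 1) / u) u := by
  have h := Real.hasDerivAt_rpow_const (x := u) (p := p - 1) (Or.inl hu.ne')
  rw [Real.rpow_sub_one hu.ne' (p - 1)] at h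
  exact h.congr_deriv (by ring)

theorem potential_one {p : ℝ} (hp : 1 < p) : potential p 1 = 0 := by
  have : p + 1 ≠ 0 := by linarith
  simp only [potential, Real.one_rpow]
  field_simp
  ring

theorem hasDerivAt_potential {p u : ℝ} (hp : 1 < p) (hu : 0 < u) :
    HasDerivAt (potential p) (potentialDeriv p u) u := by
  have hp1 : p + 1 ≠ 0 := by linarith
  have h := (((Real.hasDerivAt_rpow_const (x := u) (p := p + 1) (Or.inl hu.ne')).div_const
    (p + 1)).sub ((hasDerivAt_pow 2 u).div_const 2)).add_const ((p - 1) / (2 * (p + 1)))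
  refine h.congr_deriv ?_
  have e : u ^ (p + 1 - 1) = u * u ^ (p - 1) := by
    rw [show p + 1 - 1 = (p - 1) + 1 by ring, Real.rpow_add_one hu.ne']; ring
  rw [e, potentialDeriv]
  field_simp
  push_cast
  ring

theorem hasDerivAt_potentialDeriv (p : ℝ) {u : ℝ} (hu : 0 < u) :
    HasDerivAt (potentialDeriv p) (p * u ^ (p - 1) - 1) u := by
  refine ((hasDerivAt_id u).mul ((hasDerivAt_rpow_sub_one p hu).sub_const 1)).congr_deriv ?_
  simp only [id]
  field_simp
  ring

theorem potentialDeriv_pos {p u : ℝ} (hp : 1 < p) (hu : 1 < u) : 0 < potentialDeriv p u :=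
  mul_pos (by linarith) (sub_pos.2 (Real.one_lt_rpow hu (by linarith)))

theorem potentialDeriv_neg {p u : ℝ} (hp : 1 < p) (hu : 0 < u) (hu1 : u < 1) :
    potentialDeriv p u < 0 :=
  mul_neg_of_pos_of_neg hu (sub_neg.2 (Real.rpow_lt_one hu.le hu1 (by linarith)))

theorem strictMonoOn_Ici_of_hasDerivAt {f f' : ℝ → ℝ} {a : ℝ}
    (hf : ∀ x, a ≤ x → HasDerivAt f (f' x) x) (hpos : ∀ x, a < x → 0 < f' x) :
    StrictMonoOn f (Ici a) := by
  refine strictMonoOn_of_deriv_pos (convex_Ici a)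
    (fun x hx => (hf x hx).continuousAt.continuousWithinAt) fun x hx => ?_
  rw [interior_Ici] at hx
  rw [(hf x (le_of_lt hx)).deriv]
  exact hpos x hx

theorem strictAntiOn_Ioc_of_hasDerivAt {f f' : ℝ → ℝ} {a b : ℝ}
    (hf : ∀ x ∈ Ioc a b, HasDerivAt f (f' x) x) (hneg : ∀ x ∈ Ioo a b, f' x < 0) :
    StrictAntiOn f (Ioc a b) := by
  refine strictAntiOn_of_deriv_neg (convex_Ioc a b)
    (fun x hx => (hf x hx).continuousAt.continuousWithinAt) fun x hx => ?_
  rw [interior_Ioc] at hx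
  rw [(hf x (Ioo_subset_Ioc_self hx)).deriv]
  exact hneg x hx

theorem strictMonoOn_potential {p : ℝ} (hp : 1 < p) : StrictMonoOn (potential p) (Ici 1) :=
  strictMonoOn_Ici_of_hasDerivAt (fun _ hx => hasDerivAt_potential hp (by linarith))
    fun _ hx => potentialDeriv_pos hp hx

theorem strictAntiOn_potential {p : ℝ} (hp : 1 < p) : StrictAntiOn (potential p) (Ioc 0 1) :=
  strictAntiOn_Ioc_of_hasDerivAt (fun _ hx => hasDerivAt_potential hp hx.1)
    fun _ hx => potentialDeriv_neg hp hx.1 hx.2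

theorem potential_pos {p u : ℝ} (hp : 1 < p) (hu : 0 < u) (hu1 : u ≠ 1) :
    0 < potential p u := by
  rw [← potential_one hp]
  rcases hu1.lt_or_gt with h | h
  · exact strictAntiOn_potential hp ⟨hu, h.le⟩ ⟨one_pos, le_rfl⟩ h
  · exact strictMonoOn_potential hp self_mem_Ici h.le h

/-- The function `V - V'² V'' u / (2 (p-1)² u^(p-1))`, whose sign governs the monotonicity of
`periodDefect`. -/
noncomputable def potentialGap (p u : ℝ) : ℝ :=
  potential p u - u ^ 3 * (u ^ (p - 1) - 1) ^ 2 * (p * u ^ (p - 1) - 1) /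
    (2 * (p - 1) ^ 2 * u ^ (p - 1))

theorem potentialGap_one {p : ℝ} (hp : 1 < p) : potentialGap p 1 = 0 := by
  simp [potentialGap, potential_one hp]

theorem hasDerivAt_potentialGap {p u : ℝ} (hp : 1 < p) (hu : 0 < u) :
    HasDerivAt (potentialGap p) (u * (u ^ (p - 1) - 1) * (1 - u *
      (1 + (u ^ (p - 1) - 1) * (p * (2 * p + 1) * u ^ (p - 1) - (4 - p)) /
        (2 * (p - 1) ^ 2 * u ^ (p - 1))))) u := by
  have hw := hasDerivAt_rpow_sub_one p hu
  have hw0 : 0 < u ^ (p - 1) := Real.rpow_pos_of_pos hu _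
  have hq : p - 1 ≠ 0 := by linarith
  have hden : 2 * (p - 1) ^ 2 * u ^ (p - 1) ≠ 0 := by positivity
  refine ((hasDerivAt_potential hp hu).sub (((((hasDerivAt_pow 3 u).mul
    ((hw.sub_const 1).pow 2)).mul ((hw.const_mul p).sub_const 1))).div
    (hw.const_mul (2 * (p - 1) ^ 2)) hden)).congr_deriv ?_
  simp only [potentialDeriv, Pi.mul_apply, Pi.pow_apply]
  generalize u ^ (p - 1) = w at *
  field_simp
  push_cast
  ring

theorem potentialGap_neg {p u : ℝ} (hp : 1 < p) (hu : 1 < u) : potentialGap p u < 0 := by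
  have hanti : StrictMonoOn (fun x => -potentialGap p x) (Ici 1) := by
    refine strictMonoOn_Ici_of_hasDerivAt
      (fun x hx => (hasDerivAt_potentialGap hp (by linarith)).neg) fun x hx => ?_
    have hw : 1 < x ^ (p - 1) := Real.one_lt_rpow hx (by linarith)
    generalize x ^ (p - 1) = w at *
    have hpw : 1 < p * w := by nlinarith
    have ha : 0 < p * (2 * p + 1) * w - (4 - p) := by nlinarith
    have hb : 0 < (w - 1) * (p * (2 * p + 1) * w - (4 - p)) / (2 * (p - 1) ^ 2 * w) :=
      div_pos (mul_pos (by linarith) ha)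
        (mul_pos (mul_pos two_pos (pow_pos (by linarith) 2)) (by linarith))
    rw [neg_pos]
    exact mul_neg_of_pos_of_neg (mul_pos (by linarith) (by linarith)) (by nlinarith)
  have h := hanti self_mem_Ici hu.le hu
  simp only [potentialGap_one hp] at h
  linarith

theorem potentialGap_pos {p u : ℝ} (hp : 1 < p) (hu : 0 < u) (hu1 : u < 1)
    (hw : 1 < p * u ^ (p - 1)) : 0 < potentialGap p u := by
  have hanti : StrictAntiOn (potentialGap p) (Icc u 1) := by
    refine strictAntiOn_of_deriv_neg (convex_Icc u 1) (fun x hx =>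
      (hasDerivAt_potentialGap hp (hu.trans_le hx.1)).continuousAt.continuousWithinAt)
      fun x hx => ?_
    rw [interior_Icc] at hx
    have hx0 : 0 < x := hu.trans hx.1
    rw [(hasDerivAt_potentialGap hp hx0).deriv]
    have hux : u ^ (p - 1) < x ^ (p - 1) := Real.rpow_lt_rpow hu.le hx.1 (by linarith)
    have hx1 : x ^ (p - 1) < 1 := Real.rpow_lt_one hx0.le hx.2 (by linarith)
    have hw0 : 0 < x ^ (p - 1) := Real.rpow_pos_of_pos hx0 _
    generalize u ^ (p - 1) = v at *
    generalize x ^ (p - 1) = w at *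
    have hpw : 1 < p * w := by nlinarith
    have ha : 0 < p * (2 * p + 1) * w - (4 - p) := by nlinarith
    have hb : (w - 1) * (p * (2 * p + 1) * w - (4 - p)) / (2 * (p - 1) ^ 2 * w) < 0 :=
      div_neg_of_neg_of_pos (mul_neg_of_neg_of_pos (by linarith) ha)
        (mul_pos (mul_pos two_pos (pow_pos (by linarith) 2)) (by linarith))
    exact mul_neg_of_neg_of_pos (mul_neg_of_pos_of_neg hx0 (by linarith))
      (by nlinarith [hx.2])
  rw [← potentialGap_one hp]
  exact hanti ⟨le_rfl, hu1.le⟩ ⟨hu1.le, le_rfl⟩ hu1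

/-- The quantity `V'² + p / (3 (p-1)) V'³ - 2 V V''`. -/
noncomputable def periodDefect (p u : ℝ) : ℝ :=
  potentialDeriv p u ^ 2 + p / (3 * (p - 1)) * potentialDeriv p u ^ 3
    - 2 * potential p u * (p * u ^ (p - 1) - 1)

theorem periodDefect_one {p : ℝ} (hp : 1 < p) : periodDefect p 1 = 0 := by
  simp [periodDefect, potentialDeriv, potential_one hp]

theorem hasDerivAt_periodDefect {p u : ℝ} (hp : 1 < p) (hu : 0 < u) :
    HasDerivAt (periodDefect p) (p / (p - 1) * (potentialDeriv p u ^ 2 * (p * u ^ (p - 1) - 1)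
      - 2 * (p - 1) ^ 2 * potential p u * u ^ (p - 1) / u)) u := by
  have hV := hasDerivAt_potential hp hu
  have hV' := hasDerivAt_potentialDeriv p hu
  have hV'' := ((hasDerivAt_rpow_sub_one p hu).const_mul p).sub_const 1
  have hq : p - 1 ≠ 0 := by linarith
  refine (((hV'.pow 2).add ((hV'.pow 3).const_mul (p / (3 * (p - 1))))).sub
    ((hV.const_mul 2).mul hV'')).congr_deriv ?_
  field_simp
  push_cast
  ring

theorem deriv_periodDefect_eq_gap {p u : ℝ} (hp : 1 < p) (hu : 0 < u) :
    potentialDeriv p u ^ 2 * (p * u ^ (p - 1) - 1)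
      - 2 * (p - 1) ^ 2 * potential p u * u ^ (p - 1) / u =
    -(2 * (p - 1) ^ 2 * u ^ (p - 1) / u) * potentialGap p u := by
  have hw0 : 0 < u ^ (p - 1) := Real.rpow_pos_of_pos hu _
  have hq : p - 1 ≠ 0 := by linarith
  simp only [potentialGap, potentialDeriv]
  field_simp
  ring

theorem periodDefect_pos {p u : ℝ} (hp : 1 < p) (hu : 0 < u) (hu1 : u ≠ 1) :
    0 < periodDefect p u := by
  have hq : 0 < p - 1 := by linarith
  have hp0 : 0 < p / (p - 1) := div_pos (by linarith) hq
  rw [← periodDefect_one hp]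
  rcases hu1.lt_or_gt with h | h
  · refine strictAntiOn_Ioc_of_hasDerivAt (fun x hx => hasDerivAt_periodDefect hp hx.1)
      (fun x hx => ?_) ⟨hu, h.le⟩ ⟨one_pos, le_rfl⟩ h
    have hw0 : 0 < x ^ (p - 1) := Real.rpow_pos_of_pos hx.1 _
    have hx0 := hx.1
    refine mul_neg_of_pos_of_neg hp0 ?_
    rcases le_or_gt (p * x ^ (p - 1)) 1 with hw | hw
    · have hV := potential_pos hp hx.1 hx.2.ne
      have h1 : 0 < 2 * (p - 1) ^ 2 * potential p x * x ^ (p - 1) / x := by positivity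
      have h2 : potentialDeriv p x ^ 2 * (p * x ^ (p - 1) - 1) ≤ 0 :=
        mul_nonpos_of_nonneg_of_nonpos (sq_nonneg _) (by linarith)
      linarith
    · rw [deriv_periodDefect_eq_gap hp hx.1]
      exact mul_neg_of_neg_of_pos (neg_neg_of_pos (by positivity))
        (potentialGap_pos hp hx.1 hx.2 hw)
  · refine strictMonoOn_Ici_of_hasDerivAt
      (fun x hx => hasDerivAt_periodDefect hp (one_pos.trans_le hx))
      (fun x hx => ?_) self_mem_Ici h.le h
    have hx0 : 0 < x := one_pos.trans hx
    have hw0 : 0 < x ^ (p - 1) := Real.rpow_pos_of_pos hx0 _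
    rw [deriv_periodDefect_eq_gap hp hx0]
    exact mul_pos hp0 (mul_pos_of_neg_of_neg (neg_neg_of_pos (by positivity))
      (potentialGap_neg hp hx))

/-- The function `√V (1 / V' + p / (3 (p-1)))`. -/
noncomputable def periodWeight (p u : ℝ) : ℝ :=
  √(potential p u) * ((potentialDeriv p u)⁻¹ + p / (3 * (p - 1)))

theorem potentialDeriv_ne_zero {p u : ℝ} (hp : 1 < p) (hu : 0 < u) (hu1 : u ≠ 1) :
    potentialDeriv p u ≠ 0 := by
  rcases hu1.lt_or_gt with h | h
  · exact (potentialDeriv_neg hp hu h).ne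
  · exact (potentialDeriv_pos hp h).ne'

theorem hasDerivAt_periodWeight {p u : ℝ} (hp : 1 < p) (hu : 0 < u) (hu1 : u ≠ 1) :
    HasDerivAt (periodWeight p)
      (periodDefect p u / (2 * √(potential p u) * potentialDeriv p u ^ 2)) u := by
  have hV := potential_pos hp hu hu1
  have hV' := potentialDeriv_ne_zero hp hu hu1
  have hs : √(potential p u) ≠ 0 := (Real.sqrt_pos.2 hV).ne'
  have hq : p - 1 ≠ 0 := by linarith
  refine (((hasDerivAt_potential hp hu).sqrt hV.ne').mul
    (((hasDerivAt_potentialDeriv p hu).inv hV').add_const _)).congr_deriv ?_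
  have hsq := Real.sq_sqrt hV.le
  simp only [periodDefect, Pi.inv_apply]
  generalize √(potential p u) = r at *
  rw [← hsq]
  field_simp
  ring

theorem strictMonoOn_periodWeight {p : ℝ} (hp : 1 < p) {s : Set ℝ} (hs : Convex ℝ s)
    (hpos : ∀ u ∈ s, 0 < u) (hne : ∀ u ∈ s, u ≠ 1) : StrictMonoOn (periodWeight p) s := by
  refine strictMonoOn_of_deriv_pos hs (fun u hu =>
    (hasDerivAt_periodWeight hp (hpos u hu) (hne u hu)).continuousAt.continuousWithinAt)
    fun u hu => ?_
  replace hu := interior_subset hu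
  rw [(hasDerivAt_periodWeight hp (hpos u hu) (hne u hu)).deriv]
  have := potentialDeriv_ne_zero hp (hpos u hu) (hne u hu)
  exact div_pos (periodDefect_pos hp (hpos u hu) (hne u hu))
    (mul_pos (mul_pos two_pos (Real.sqrt_pos.2 (potential_pos hp (hpos u hu) (hne u hu))))
      (by positivity))

/-- The integrand obtained from `∫ (E - V)^(-1/2)` on a monotone branch `U` of the inverse of `V`
by the substitution `t = V(u) / E`. -/
noncomputable def branchIntegrand (V' U : ℝ → ℝ) (E t : ℝ) : ℝ :=
  √(E * t) / |V' (U (E * t))| * (√(1 - t) * √t)⁻¹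

section Substitution

variable {V V' U : ℝ → ℝ} {E : ℝ} {s : Set ℝ}

theorem rpow_eq_abs_mul_branchIntegrand (hE : 0 < E) (h0 : ∀ u ∈ s, V' u ≠ 0)
    (hV : MapsTo V s (Ioo 0 E)) (hUV : LeftInvOn U V s) {u : ℝ} (hu : u ∈ s) :
    (E - V u) ^ (-(1 / 2) : ℝ) = |V' u / E| • branchIntegrand V' U E (V u / E) := by
  obtain ⟨hV0, hVE⟩ := hV hu
  have hVE' : 0 < E - V u := sub_pos.2 hVE
  have h1 : 1 - V u / E = (E - V u) / E := by field_simp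
  have hsE : √E ≠ 0 := (Real.sqrt_pos.2 hE).ne'
  have hsV : √(V u) ≠ 0 := (Real.sqrt_pos.2 hV0).ne'
  have hsEV : √(E - V u) ≠ 0 := (Real.sqrt_pos.2 hVE').ne'
  have habs : |V' u| ≠ 0 := abs_ne_zero.2 (h0 u hu)
  have hsq : √E ^ 2 = E := Real.sq_sqrt hE.le
  rw [branchIntegrand, mul_div_cancel₀ _ hE.ne', hUV hu, h1, Real.sqrt_div hVE'.le,
    Real.sqrt_div hV0.le, abs_div, abs_of_pos hE, Real.rpow_neg hVE'.le, ← Real.sqrt_eq_rpow,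
    smul_eq_mul]
  field_simp
  exact hsq.symm

theorem image_div_eq_Ioo (hE : 0 < E) (hV : MapsTo V s (Ioo 0 E)) (hU : MapsTo U (Ioo 0 E) s)
    (hVU : LeftInvOn V U (Ioo 0 E)) : (fun u => V u / E) '' s = Ioo 0 1 := by
  ext t
  constructor
  · rintro ⟨u, hu, rfl⟩
    exact ⟨div_pos (hV hu).1 hE, (div_lt_one hE).2 (hV hu).2⟩
  · intro ht
    have hEt : E * t ∈ Ioo 0 E := ⟨mul_pos hE ht.1, mul_lt_of_lt_one_right hE ht.2⟩
    exact ⟨U (E * t), hU hEt, by simp only [hVU hEt]; field_simp⟩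

theorem injOn_div (hE : 0 < E) (hUV : LeftInvOn U V s) : InjOn (fun u => V u / E) s :=
  fun _ hx _ hy h => hUV.injOn hx hy ((div_left_inj' hE.ne').1 h)

theorem setIntegral_rpow_eq_branchIntegrand (hE : 0 < E) (hs : MeasurableSet s)
    (hd : ∀ u ∈ s, HasDerivAt V (V' u) u) (h0 : ∀ u ∈ s, V' u ≠ 0)
    (hV : MapsTo V s (Ioo 0 E)) (hU : MapsTo U (Ioo 0 E) s) (hUV : LeftInvOn U V s)
    (hVU : LeftInvOn V U (Ioo 0 E)) :
    ∫ u in s, (E - V u) ^ (-(1 / 2) : ℝ) = ∫ t in Ioo 0 1, branchIntegrand V' U E t := by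
  rw [← image_div_eq_Ioo hE hV hU hVU, integral_image_eq_integral_abs_deriv_smul hs
    (fun u hu => ((hd u hu).div_const E).hasDerivWithinAt) (injOn_div hE hUV)]
  exact setIntegral_congr_fun hs fun u hu => rpow_eq_abs_mul_branchIntegrand hE h0 hV hUV hu

theorem integrableOn_branchIntegrand (hE : 0 < E) (hs : MeasurableSet s)
    (hd : ∀ u ∈ s, HasDerivAt V (V' u) u) (h0 : ∀ u ∈ s, V' u ≠ 0)
    (hV : MapsTo V s (Ioo 0 E)) (hU : MapsTo U (Ioo 0 E) s) (hUV : LeftInvOn U V s)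
    (hVU : LeftInvOn V U (Ioo 0 E))
    (hint : IntegrableOn (fun u => (E - V u) ^ (-(1 / 2) : ℝ)) s) :
    IntegrableOn (branchIntegrand V' U E) (Ioo 0 1) := by
  rw [← image_div_eq_Ioo hE hV hU hVU, integrableOn_image_iff_integrableOn_abs_deriv_smul hs
    (fun u hu => ((hd u hu).div_const E).hasDerivWithinAt) (injOn_div hE hUV)]
  exact hint.congr_fun (fun u hu => rpow_eq_abs_mul_branchIntegrand hE h0 hV hUV hu) hs

end Substitution

theorem integrableOn_sub_rpow_neg_half {E : ℝ} (hE : 0 ≤ E) :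
    IntegrableOn (fun y : ℝ => (E - y) ^ (-(1 / 2) : ℝ)) (Ioo 0 E) := by
  have h : IntervalIntegrable (fun y : ℝ => y ^ (-(1 / 2) : ℝ)) volume 0 E :=
    intervalIntegral.intervalIntegrable_rpow' (by norm_num)
  have h' := (h.comp_sub_left E).symm
  simp only [sub_self, sub_zero] at h'
  exact (intervalIntegrable_iff_integrableOn_Ioo_of_le hE).1 h'

/-- Integrability of `(E - V)^(-1/2)` near a turning point, where `V'` does not vanish. -/
theorem integrableOn_rpow_of_deriv_ne_zero {V V' : ℝ → ℝ} {E a b : ℝ} (hE : 0 ≤ E)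
    (hd : ∀ u ∈ Icc a b, HasDerivAt V (V' u) u) (hc : ContinuousOn V' (Icc a b))
    (h0 : ∀ u ∈ Icc a b, V' u ≠ 0) (hinj : InjOn V (Icc a b))
    (hV : MapsTo V (Ioo a b) (Ioo 0 E)) :
    IntegrableOn (fun u => (E - V u) ^ (-(1 / 2) : ℝ)) (Icc a b) := by
  have h1 : IntegrableOn (fun u => |V' u| • (E - V u) ^ (-(1 / 2) : ℝ)) (Ioo a b) :=
    (integrableOn_image_iff_integrableOn_abs_deriv_smul measurableSet_Ioo
      (fun u hu => (hd u (Ioo_subset_Icc_self hu)).hasDerivWithinAt)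
      (hinj.mono Ioo_subset_Icc_self) _).1
      ((integrableOn_sub_rpow_neg_half hE).mono_set hV.image_subset)
  rw [← integrableOn_Icc_iff_integrableOn_Ioo] at h1
  refine (IntegrableOn.continuousOn_mul (hc.abs.inv₀ fun u hu => abs_ne_zero.2 (h0 u hu)) h1
    isCompact_Icc).congr_fun (fun u hu => ?_) measurableSet_Icc
  have := abs_ne_zero.2 (h0 u hu)
  simp only [Pi.inv_apply, smul_eq_mul]
  field_simp

theorem continuousOn_potentialDeriv (p : ℝ) : ContinuousOn (potentialDeriv p) (Ioi 0) :=
  fun _ hu => (hasDerivAt_potentialDeriv p hu).continuousAt.continuousWithinAt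

/-- Off the endpoints, a point between the two turning points lies below the energy level. -/
theorem potential_lt_of_mem_Ioo {p a b E u : ℝ} (hp : 1 < p) (ha : a ∈ Ioo (0 : ℝ) 1)
    (hb : 1 < b) (hVa : potential p a = E) (hVb : potential p b = E) (hu : u ∈ Ioo a b) :
    potential p u < E := by
  rcases le_total u 1 with h | h
  · rw [← hVa]
    exact strictAntiOn_potential hp ⟨ha.1, ha.2.le⟩ ⟨ha.1.trans hu.1, h⟩ hu.1
  · rw [← hVb]
    exact strictMonoOn_potential hp h hb.le hu.2

theorem integrableOn_potential_rpow {p a b E : ℝ} (hp : 1 < p) (ha : a ∈ Ioo (0 : ℝ) 1)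
    (hb : 1 < b) (hVa : potential p a = E) (hVb : potential p b = E) :
    IntegrableOn (fun u => (E - potential p u) ^ (-(1 / 2) : ℝ)) (Icc a b) := by
  have hE : 0 < E := (potential_pos hp ha.1 ha.2.ne).trans_eq hVa
  obtain ⟨c, hac, hc1⟩ := exists_between ha.2
  obtain ⟨d, h1d, hdb⟩ := exists_between hb
  have ha0 := ha.1
  have hleft : IntegrableOn (fun u => (E - potential p u) ^ (-(1 / 2) : ℝ)) (Icc a c) := by
    refine integrableOn_rpow_of_deriv_ne_zero hE.le
      (fun u hu => hasDerivAt_potential hp (ha0.trans_le hu.1))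
      ((continuousOn_potentialDeriv p).mono fun u hu => ha0.trans_le hu.1)
      (fun u hu => (potentialDeriv_neg hp (ha0.trans_le hu.1) (hu.2.trans_lt hc1)).ne)
      ((strictAntiOn_potential hp).injOn.mono
        (Icc_subset_Ioc_iff hac.le |>.2 ⟨ha0, hc1.le⟩))
      fun u hu => ⟨potential_pos hp (ha0.trans hu.1) (hu.2.trans hc1).ne,
        potential_lt_of_mem_Ioo hp ha hb hVa hVb ⟨hu.1, by linarith [hu.2]⟩⟩
  have hright : IntegrableOn (fun u => (E - potential p u) ^ (-(1 / 2) : ℝ)) (Icc d b) := by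
    refine integrableOn_rpow_of_deriv_ne_zero hE.le
      (fun u hu => hasDerivAt_potential hp (by linarith [hu.1]))
      ((continuousOn_potentialDeriv p).mono fun u hu => mem_Ioi.2 (by linarith [hu.1]))
      (fun u hu => (potentialDeriv_pos hp (h1d.trans_le hu.1)).ne')
      ((strictMonoOn_potential hp).injOn.mono fun u hu => h1d.le.trans hu.1)
      fun u hu => ⟨potential_pos hp (by linarith [hu.1]) (h1d.trans hu.1).ne',
        potential_lt_of_mem_Ioo hp ha hb hVa hVb ⟨by linarith [hu.1], hu.2⟩⟩
  have hmid : IntegrableOn (fun u => (E - potential p u) ^ (-(1 / 2) : ℝ)) (Icc c d) := by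
    refine ContinuousOn.integrableOn_Icc fun u hu => ContinuousAt.continuousWithinAt ?_
    have hu0 : 0 < u := by linarith [hu.1]
    have hlt := potential_lt_of_mem_Ioo hp ha hb hVa hVb
      (u := u) ⟨by linarith [hu.1], by linarith [hu.2]⟩
    exact (continuousAt_const.sub (hasDerivAt_potential hp hu0).continuousAt).rpow_const
      (Or.inl (sub_pos.2 hlt).ne')
  rw [← Icc_union_Icc_eq_Icc (hac.le.trans (hc1.le.trans h1d.le)) hdb.le,
    ← Icc_union_Icc_eq_Icc hac.le (hc1.le.trans h1d.le)]
  exact (hleft.union hmid).union hright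

section Period

variable {p : ℝ} {um up : ℝ → ℝ} {c : ℝ}

theorem integrableOn_and_integral_eq (hp : 1 < p)
    (hum : ∀ E ∈ Ioo 0 c, um E ∈ Ioo (0 : ℝ) 1 ∧ potential p (um E) = E)
    (hup : ∀ E ∈ Ioo 0 c, up E ∈ Ioi (1 : ℝ) ∧ potential p (up E) = E)
    {E : ℝ} (hE : E ∈ Ioo 0 c) :
    IntegrableOn (fun t => branchIntegrand (potentialDeriv p) um E t +
        branchIntegrand (potentialDeriv p) up E t) (Ioo 0 1) ∧
      ∫ u in (um E)..(up E), (E - potential p u) ^ (-(1 / 2) : ℝ) =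
        ∫ t in Ioo 0 1, (branchIntegrand (potentialDeriv p) um E t +
          branchIntegrand (potentialDeriv p) up E t) := by
  obtain ⟨ha, hVa⟩ := hum E hE
  obtain ⟨hb, hVb⟩ := hup E hE
  rw [mem_Ioi] at hb
  have hE0 := hE.1
  have hint := integrableOn_potential_rpow hp ha hb hVa hVb
  have hsub : ∀ {e}, e ∈ Ioo 0 E → e ∈ Ioo 0 c := fun he => ⟨he.1, he.2.trans hE.2⟩
  have hLint := hint.mono_set (Ioo_subset_Icc_self.trans (Icc_subset_Icc_right hb.le) :
    Ioo (um E) 1 ⊆ _)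
  have hRint := hint.mono_set (Ioo_subset_Icc_self.trans (Icc_subset_Icc_left ha.2.le) :
    Ioo 1 (up E) ⊆ _)
  have hLd : ∀ u ∈ Ioo (um E) 1, HasDerivAt (potential p) (potentialDeriv p u) u :=
    fun u hu => hasDerivAt_potential hp (ha.1.trans hu.1)
  have hRd : ∀ u ∈ Ioo 1 (up E), HasDerivAt (potential p) (potentialDeriv p u) u :=
    fun u hu => hasDerivAt_potential hp (one_pos.trans hu.1)
  have hL0 : ∀ u ∈ Ioo (um E) 1, potentialDeriv p u ≠ 0 :=
    fun u hu => (potentialDeriv_neg hp (ha.1.trans hu.1) hu.2).ne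
  have hR0 : ∀ u ∈ Ioo 1 (up E), potentialDeriv p u ≠ 0 :=
    fun u hu => (potentialDeriv_pos hp hu.1).ne'
  have hLV : MapsTo (potential p) (Ioo (um E) 1) (Ioo 0 E) := fun u hu =>
    ⟨potential_pos hp (ha.1.trans hu.1) hu.2.ne,
      potential_lt_of_mem_Ioo hp ha hb hVa hVb ⟨hu.1, hu.2.trans hb⟩⟩
  have hRV : MapsTo (potential p) (Ioo 1 (up E)) (Ioo 0 E) := fun u hu =>
    ⟨potential_pos hp (one_pos.trans hu.1) hu.1.ne',
      potential_lt_of_mem_Ioo hp ha hb hVa hVb ⟨ha.2.trans hu.1, hu.2⟩⟩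
  have hLU : MapsTo um (Ioo 0 E) (Ioo (um E) 1) := fun e he => by
    obtain ⟨he1, he2⟩ := hum e (hsub he)
    refine ⟨((strictAntiOn_potential hp).lt_iff_gt ⟨he1.1, he1.2.le⟩ ⟨ha.1, ha.2.le⟩).1 ?_, he1.2⟩
    rw [he2, hVa]; exact he.2
  have hRU : MapsTo up (Ioo 0 E) (Ioo 1 (up E)) := fun e he => by
    obtain ⟨he1, he2⟩ := hup e (hsub he)
    rw [mem_Ioi] at he1
    refine ⟨he1, ((strictMonoOn_potential hp).lt_iff_lt he1.le hb.le).1 ?_⟩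
    rw [he2, hVb]; exact he.2
  have hLVU : LeftInvOn (potential p) um (Ioo 0 E) := fun e he => (hum e (hsub he)).2
  have hRVU : LeftInvOn (potential p) up (Ioo 0 E) := fun e he => (hup e (hsub he)).2
  have hLUV : LeftInvOn um (potential p) (Ioo (um E) 1) := fun u hu => by
    have h := hLU (hLV hu)
    exact (strictAntiOn_potential hp).injOn ⟨ha.1.trans h.1, h.2.le⟩ ⟨ha.1.trans hu.1, hu.2.le⟩
      (hLVU (hLV hu))
  have hRUV : LeftInvOn up (potential p) (Ioo 1 (up E)) := fun u hu =>
    (strictMonoOn_potential hp).injOn (hRU (hRV hu)).1.le hu.1.le (hRVU (hRV hu))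
  have hLi := integrableOn_branchIntegrand hE0 measurableSet_Ioo hLd hL0 hLV hLU hLUV hLVU hLint
  have hRi := integrableOn_branchIntegrand hE0 measurableSet_Ioo hRd hR0 hRV hRU hRUV hRVU hRint
  refine ⟨hLi.add hRi, ?_⟩
  rw [integral_add hLi hRi,
    ← setIntegral_rpow_eq_branchIntegrand hE0 measurableSet_Ioo hLd hL0 hLV hLU hLUV hLVU,
    ← setIntegral_rpow_eq_branchIntegrand hE0 measurableSet_Ioo hRd hR0 hRV hRU hRUV hRVU,
    ← intervalIntegral.integral_add_adjacent_intervals (b := 1)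
      ((intervalIntegrable_iff_integrableOn_Ioo_of_le ha.2.le).2 hLint)
      ((intervalIntegrable_iff_integrableOn_Ioo_of_le hb.le).2 hRint),
    intervalIntegral.integral_of_le ha.2.le, intervalIntegral.integral_of_le hb.le,
    integral_Ioc_eq_integral_Ioo, integral_Ioc_eq_integral_Ioo]

theorem branchIntegrand_add_eq (hp : 1 < p)
    (hum : ∀ E ∈ Ioo 0 c, um E ∈ Ioo (0 : ℝ) 1 ∧ potential p (um E) = E)
    (hup : ∀ E ∈ Ioo 0 c, up E ∈ Ioi (1 : ℝ) ∧ potential p (up E) = E)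
    {E t : ℝ} (hEt : E * t ∈ Ioo 0 c) :
    branchIntegrand (potentialDeriv p) um E t + branchIntegrand (potentialDeriv p) up E t =
      (periodWeight p (up (E * t)) - periodWeight p (um (E * t))) * (√(1 - t) * √t)⁻¹ := by
  obtain ⟨ha, hVa⟩ := hum _ hEt
  obtain ⟨hb, hVb⟩ := hup _ hEt
  rw [branchIntegrand, branchIntegrand, periodWeight, periodWeight, hVa, hVb,
    abs_of_neg (potentialDeriv_neg hp ha.1 ha.2), abs_of_pos (potentialDeriv_pos hp hb), div_neg]
  ring

theorem strictMonoOn_periodWeight_sub (hp : 1 < p)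
    (hum : ∀ E ∈ Ioo 0 c, um E ∈ Ioo (0 : ℝ) 1 ∧ potential p (um E) = E)
    (hup : ∀ E ∈ Ioo 0 c, up E ∈ Ioi (1 : ℝ) ∧ potential p (up E) = E) :
    StrictMonoOn (fun e => periodWeight p (up e) - periodWeight p (um e)) (Ioo 0 c) := by
  intro e he e' he' hlt
  obtain ⟨ha, hVa⟩ := hum _ he
  obtain ⟨hb, hVb⟩ := hup _ he
  obtain ⟨ha', hVa'⟩ := hum _ he'
  obtain ⟨hb', hVb'⟩ := hup _ he'
  have hm : um e' < um e :=
    ((strictAntiOn_potential hp).lt_iff_gt ⟨ha.1, ha.2.le⟩ ⟨ha'.1, ha'.2.le⟩).1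
      (by rwa [hVa, hVa'])
  have hu : up e < up e' :=
    ((strictMonoOn_potential hp).lt_iff_lt hb.out.le hb'.out.le).1 (by rwa [hVb, hVb'])
  have h1 := strictMonoOn_periodWeight hp (convex_Ioo 0 1) (fun u hu => hu.1)
    (fun u hu => hu.2.ne) ha' ha hm
  have h2 := strictMonoOn_periodWeight hp (convex_Ioi 1) (fun u hu => one_pos.trans hu)
    (fun u hu => ne_of_gt hu) hb hb' hu
  exact sub_lt_sub h2 h1

end Period

/-- For `p > 1` and the potential
`V(u) = u^(p+1)/(p+1) - u^2/2 + (p-1)/(2(p+1))`, the period function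
`T(E) = 2 ∫_{u₋(E)}^{u₊(E)} (E - V(u))^{-1/2} du` is strictly increasing on
`(0, (p-1)/(2(p+1)))`, where `u₋(E) ∈ (0,1)` and `u₊(E) ∈ (1,∞)` are the two
solutions of `V(u) = E`. -/
theorem period_strictMono
    (p : ℝ) (hp : 1 < p)
    (V : ℝ → ℝ)
    (hV : ∀ u : ℝ, V u = u ^ (p + 1) / (p + 1) - u ^ 2 / 2 + (p - 1) / (2 * (p + 1)))
    (um up : ℝ → ℝ)
    (hum : ∀ E ∈ Set.Ioo (0 : ℝ) ((p - 1) / (2 * (p + 1))),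
      um E ∈ Set.Ioo (0 : ℝ) 1 ∧ V (um E) = E)
    (hup : ∀ E ∈ Set.Ioo (0 : ℝ) ((p - 1) / (2 * (p + 1))),
      up E ∈ Set.Ioi (1 : ℝ) ∧ V (up E) = E)
    (T : ℝ → ℝ)
    (hT : ∀ E ∈ Set.Ioo (0 : ℝ) ((p - 1) / (2 * (p + 1))),
      T E = 2 * ∫ u in (um E)..(up E), (E - V u) ^ (-(1 / 2) : ℝ)) :
    StrictMonoOn T (Set.Ioo (0 : ℝ) ((p - 1) / (2 * (p + 1)))) := by
  obtain rfl : V = potential p := funext hV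
  intro E₁ h₁ E₂ h₂ hlt
  obtain ⟨hi₁, he₁⟩ := integrableOn_and_integral_eq hp hum hup h₁
  obtain ⟨hi₂, he₂⟩ := integrableOn_and_integral_eq hp hum hup h₂
  rw [hT E₁ h₁, hT E₂ h₂, he₁, he₂]
  refine mul_lt_mul_of_pos_left (sub_pos.1 ?_) two_pos
  rw [← integral_sub hi₂ hi₁, ← integral_Ioc_eq_integral_Ioo,
    ← intervalIntegral.integral_of_le zero_le_one]
  refine intervalIntegral.intervalIntegral_pos_of_pos_on
    ((intervalIntegrable_iff_integrableOn_Ioo_of_le zero_le_one).2 (hi₂.sub hi₁))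
    (fun t ht => ?_) one_pos
  have hm : ∀ {E}, E ∈ Ioo 0 ((p - 1) / (2 * (p + 1))) →
      E * t ∈ Ioo 0 ((p - 1) / (2 * (p + 1))) := fun hE =>
    ⟨mul_pos hE.1 ht.1, (mul_lt_of_lt_one_right hE.1 ht.2).trans hE.2⟩
  rw [branchIntegrand_add_eq hp hum hup (hm h₁), branchIntegrand_add_eq hp hum hup (hm h₂),
    ← sub_mul]
  exact mul_pos (sub_pos.2 (strictMonoOn_periodWeight_sub hp hum hup (hm h₁) (hm h₂)
    (mul_lt_mul_of_pos_right hlt ht.1)))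
    (inv_pos.2 (mul_pos (Real.sqrt_pos.2 (sub_pos.2 ht.2)) (Real.sqrt_pos.2 ht.1)))
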